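/- arXiv:1703.10522 — 2 statements merged into one kernel-verified Lean document; each statement's English description precedes it below -/
import Mathlib

section
/- For every finite alphabet A and all integers m ≥ 0 and n ≥ 0, there exists an integer N such that every word w over A of length at least N encounters Z_{m,n} through a non-erasing morphism h respecting reversal with the additional property that the h-images of all fragments of Z_{m,n} are one and the same factor of w. -/
/-!
Formalization framework: a variable alphabet `Σ` is a type `V`; the letter
`(x, false)` represents the variable `x` and `(x, true)` represents its mirror
image `x^R`.  A pattern with reversal is a `List (V × Bool)`, and a formula
with reversal is a set of such patterns (finiteness and nonemptiness of
fragments are taken as hypotheses where relevant).  A morphism respecting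
reversal is determined by its values `h : V → List A` on plain variables.
-/

/-- The image of a pattern with reversal under the reversal-respecting extension of `h`. -/
def applyRev {V A : Type*} (h : V → List A) (p : List (V × Bool)) : List A :=
  p.flatMap fun z => if z.2 then (h z.1).reverse else h z.1

/-- A morphism is non-erasing if it sends no variable to the empty word. -/
def NonErasing {V A : Type*} (h : V → List A) : Prop := ∀ x, h x ≠ []

/-- A formula with reversal `φ` occurs in a finite word `w`. -/
def OccursIn {V A : Type*} (φ : Set (List (V × Bool))) (w : List A) : Prop :=
  ∃ h : V → List A, NonErasing h ∧ ∀ p ∈ φ, applyRev h p <:+: w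

/-- A formula with reversal is avoidable: over some finite alphabet,
infinitely many finite words avoid it. -/
def FAvoidable {V : Type*} (φ : Set (List (V × Bool))) : Prop :=
  ∃ A : Type, Finite A ∧ {w : List A | ¬ OccursIn φ w}.Infinite

/-- The Zimin formulas with reversal `Z_{m,n}`, over the two-way variables
`Sum.inl i` (`i : Fin m`) and the one-way variables `Sum.inr j` (`j < n`):
`Z_{m,0} = x_1^♯ ⋯ x_m^♯` and `Z_{m,n} = Z_{m,n-1} y_n Z_{m,n-1}`. -/
def ZiminRev (m : ℕ) : ℕ → Set (List ((Fin m ⊕ ℕ) × Bool))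
  | 0 => {p | ∃ b : Fin m → Bool, p = List.ofFn fun i => (Sum.inl i, b i)}
  | n + 1 => {p | ∃ u ∈ ZiminRev m n, ∃ v ∈ ZiminRev m n,
      p = u ++ [(Sum.inr n, false)] ++ v}

/-- d-reversal: reverse a word over `Σ ∪ Σ^R` while swapping `x` with `x^R`. -/
def drev {V : Type*} (p : List (V × Bool)) : List (V × Bool) :=
  (p.map fun z => (z.1, !z.2)).reverse

/-- The image of a pattern with reversal under the d-reversal-respecting extension of `h`. -/
def applyDRev {V W : Type*} (h : V → List (W × Bool)) (p : List (V × Bool)) :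
    List (W × Bool) :=
  p.flatMap fun z => if z.2 then drev (h z.1) else h z.1

/-- `φ` divides `ψ`: some non-erasing morphism respecting d-reversal sends
every fragment of `φ` to a factor of a fragment of `ψ`. -/
def FDivides {V W : Type*} (φ : Set (List (V × Bool))) (ψ : Set (List (W × Bool))) : Prop :=
  ∃ h : V → List (W × Bool), NonErasing h ∧ ∀ p ∈ φ, ∃ q ∈ ψ, applyDRev h p <:+: q

/-- The letter `(x,b)` (i.e. `x` if `b = false`, `x^R` if `b = true`) appears in `φ`. -/
def Appears {V : Type*} (φ : Set (List (V × Bool))) (z : V × Bool) : Prop := ∃ p ∈ φ, z ∈ p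

/-- `x` is a two-way variable of `φ`: both `x` and `x^R` appear in `φ`. -/
def TwoWay {V : Type*} (φ : Set (List (V × Bool))) (x : V) : Prop :=
  Appears φ (x, false) ∧ Appears φ (x, true)

/-- `x` is a one-way variable of `φ`: exactly one of `x`, `x^R` appears in `φ`. -/
def OneWay {V : Type*} (φ : Set (List (V × Bool))) (x : V) : Prop :=
  (Appears φ (x, false) ∧ ¬ Appears φ (x, true)) ∨
  (Appears φ (x, true) ∧ ¬ Appears φ (x, false))

/-- The flattening of a pattern with reversal: forget all mirror images. -/
def flatten {V : Type*} (p : List (V × Bool)) : List V := p.map Prod.fst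

/-- A finite word is a factor of an ω-word. -/
def InfFactor {A : Type*} (u : List A) (w : ℕ → A) : Prop :=
  ∃ i : ℕ, u = (List.range u.length).map fun j => w (i + j)

/-- A formula with reversal occurs in an ω-word. -/
def OccursInInf {V A : Type*} (φ : Set (List (V × Bool))) (w : ℕ → A) : Prop :=
  ∃ h : V → List A, NonErasing h ∧ ∀ p ∈ φ, InfFactor (applyRev h p) w

/-- The image of a word (without reversal) under the extension of `h : Σ → A^*`. -/
def applyW {V A : Type*} (h : V → List A) (p : List V) : List A := p.flatMap h

/-- A formula without reversal occurs in a finite word. -/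
def OccursInW {V A : Type*} (ψ : Set (List V)) (w : List A) : Prop :=
  ∃ h : V → List A, NonErasing h ∧ ∀ p ∈ ψ, applyW h p <:+: w

/-- A formula without reversal is avoidable. -/
def WAvoidable {V : Type*} (ψ : Set (List V)) : Prop :=
  ∃ A : Type, Finite A ∧ {w : List A | ¬ OccursInW ψ w}.Infinite

/-- Every sufficiently long word over a finite alphabet contains two occurrences of the same
factor of length `L`, separated by a nonempty word. -/
theorem exists_separated_repetition (A : Type*) [Finite A] (L : ℕ) :
    ∃ M : ℕ, ∀ w : List A, M ≤ w.length →
      ∃ v g : List A, v.length = L ∧ g ≠ [] ∧ v ++ g ++ v <:+: w := by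
  have := Fintype.ofFinite A
  refine ⟨(Fintype.card (List.Vector A L) + 1) * (L + 1), fun w hw => ?_⟩
  have hlen (i : Fin (Fintype.card (List.Vector A L) + 1)) :
      (i : ℕ) * (L + 1) + (L + 1) ≤ w.length := by
    have h : ((i : ℕ) + 1) * (L + 1) ≤ (Fintype.card (List.Vector A L) + 1) * (L + 1) :=
      Nat.mul_le_mul_right _ i.2
    linarith
  let block (i : Fin (Fintype.card (List.Vector A L) + 1)) : List.Vector A L :=
    ⟨(w.drop (i * (L + 1))).take L, by
      have := hlen i
      simp only [List.length_take, List.length_drop]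
      omega⟩
  obtain ⟨i, j, hlt, hij⟩ : ∃ i j, i < j ∧ block i = block j := by
    obtain ⟨i, j, hne, hij⟩ := Fintype.exists_ne_map_eq_of_card_lt block (by simp)
    rcases lt_or_gt_of_ne hne with h | h
    exacts [⟨i, j, h, hij⟩, ⟨j, i, h, hij.symm⟩]
  have hst : (i : ℕ) * (L + 1) + (L + 1) ≤ j * (L + 1) := by
    have h : ((i : ℕ) + 1) * (L + 1) ≤ j * (L + 1) := Nat.mul_le_mul_right _ hlt
    linarith
  have hj := hlen j
  have hblock : (w.drop (i * (L + 1))).take L = (w.drop (j * (L + 1))).take L :=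
    congrArg Subtype.val hij
  generalize (i : ℕ) * (L + 1) = s at *
  generalize (j : ℕ) * (L + 1) = t at *
  refine ⟨(w.drop t).take L, (w.drop (s + L)).take (t - (s + L)), ?_, ?_,
    w.take s, w.drop (t + L), ?_⟩
  · simp only [List.length_take, List.length_drop]
    omega
  · apply List.ne_nil_of_length_pos
    simp only [List.length_take, List.length_drop]
    omega
  · have hsplit (a b : ℕ) : w.drop a = (w.drop a).take b ++ w.drop (a + b) := by
      rw [← List.drop_drop, List.take_append_drop]
    have hgap := hsplit (s + L) (t - (s + L))
    rw [show s + L + (t - (s + L)) = t by omega] at hgap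
    conv_rhs => rw [← List.take_append_drop s w, hsplit s L, hgap, hsplit t L, hblock]
    simp only [List.append_assoc]

/-- The one-way variables of `Z_{m,n}` are among `y_1, …, y_n`. -/
theorem lt_of_inr_mem_ziminRev {m n k : ℕ} {b : Bool} {p : List ((Fin m ⊕ ℕ) × Bool)}
    (hp : p ∈ ZiminRev m n) (hk : (Sum.inr k, b) ∈ p) : k < n := by
  induction n generalizing p with
  | zero =>
    obtain ⟨c, rfl⟩ := hp
    simp [List.mem_ofFn] at hk
  | succ n ih =>
    obtain ⟨u, hu, v, hv, rfl⟩ := hp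
    simp only [List.mem_append, List.mem_singleton, Prod.mk.injEq, Sum.inr.injEq] at hk
    rcases hk with (hk | hk) | hk
    · exact (ih hu hk).trans n.lt_succ_self
    · omega
    · exact (ih hv hk).trans n.lt_succ_self

theorem applyRev_append {V A : Type*} (h : V → List A) (p q : List (V × Bool)) :
    applyRev h (p ++ q) = applyRev h p ++ applyRev h q :=
  List.flatMap_append

theorem applyRev_congr {V A : Type*} {h h' : V → List A} {p : List (V × Bool)}
    (hp : ∀ z ∈ p, h z.1 = h' z.1) : applyRev h p = applyRev h' p :=
  List.flatMap_congr fun z hz => by rw [hp z hz]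

/-- A morphism sending every variable to a letter does not distinguish `x` from `x^R`. -/
theorem applyRev_singleton {V A : Type*} (f : V → A) (p : List (V × Bool)) :
    applyRev (fun x => [f x]) p = p.map fun z => f z.1 := by
  simp [applyRev, List.map_eq_flatMap]

/-- For every finite alphabet `A` and all `m, n ≥ 0`, there is `N`
such that every word over `A` of length at least `N` encounters `Z_{m,n}` through a
non-erasing morphism respecting reversal sending all fragments to one and the same
factor of `w`. -/
theorem ziminRev_occurs_uniformly (A : Type*) [Finite A] (m n : ℕ) :
    ∃ N : ℕ, ∀ w : List A, N ≤ w.length →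
      ∃ h : (Fin m ⊕ ℕ) → List A, NonErasing h ∧
        ∃ u : List A, u <:+: w ∧ ∀ p ∈ ZiminRev m n, applyRev h p = u := by
  induction n with
  | zero =>
    refine ⟨m + 1, fun w hw => ?_⟩
    let f : Fin m ⊕ ℕ → A :=
      Sum.elim (fun i => w[(i : ℕ)]) fun _ => w[0]
    refine ⟨fun x => [f x], fun x => List.cons_ne_nil _ _, w.take m,
      (List.take_prefix m w).isInfix, ?_⟩
    rintro p ⟨b, rfl⟩
    rw [applyRev_singleton]
    apply List.ext_getElem
    · simp
      omega
    · intro k hk hk'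
      simp [f]
  | succ n ih =>
    obtain ⟨L, hL⟩ := ih
    obtain ⟨M, hM⟩ := exists_separated_repetition A L
    refine ⟨M, fun w hw => ?_⟩
    obtain ⟨v, g, hv, hg, hvw⟩ := hM w hw
    obtain ⟨h, hne, u, ⟨a, b, rfl⟩, hu⟩ := hL v hv.ge
    let h' : Fin m ⊕ ℕ → List A := Function.update h (Sum.inr n) (b ++ g ++ a)
    have hu' (p) (hp : p ∈ ZiminRev m n) : applyRev h' p = u := by
      rw [← hu p hp]
      refine applyRev_congr fun z hz => Function.update_of_ne ?_ _ _
      intro hzn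
      exact (lt_of_inr_mem_ziminRev hp (b := z.2) (k := n) (hzn ▸ hz)).false
    refine ⟨h', fun x => ?_, u ++ (b ++ g ++ a) ++ u, ?_, ?_⟩
    · by_cases hx : x = Sum.inr n
      · subst hx
        simp [h', hg]
      · simpa [h', hx] using hne x
    · refine List.IsInfix.trans ⟨a, b, ?_⟩ hvw
      simp only [List.append_assoc]
    · rintro p ⟨q, hq, r, hr, rfl⟩
      rw [applyRev_append, applyRev_append, hu' q hq, hu' r hr]
      simp [applyRev, h']
end

section
/- Let φ be a formula with reversal over Σ such that every variable of Σ occurring in φ is two-way in φ. If some variable appears twice in a single fragment of the flattening φ^♭, then φ is avoidable. -/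
/-- A word over `ZMod n` is cyclic if each letter is the successor of the previous one. -/
def IsCyclicWord {n : ℕ} (l : List (ZMod n)) : Prop :=
  l.IsChain fun a b => b = a + 1

theorem isCyclicWord_map_range (n N : ℕ) :
    IsCyclicWord ((List.range N).map (Nat.cast : ℕ → ZMod n)) := by
  rw [IsCyclicWord, List.isChain_iff_getElem]
  intro i hi
  simp

theorem IsCyclicWord.factor {n : ℕ} {u w : List (ZMod n)} (hw : IsCyclicWord w)
    (h : u <:+: w) : IsCyclicWord u := by
  obtain ⟨s, t, rfl⟩ := h
  exact (List.isChain_append.1 (List.isChain_append.1 hw).1).2.1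

theorem IsCyclicWord.getElem_eq {n : ℕ} {l : List (ZMod n)} (hl : IsCyclicWord l) :
    ∀ (i : ℕ) (hi : i < l.length), l[i] = l[0] + (i : ZMod n)
  | 0, _ => by simp
  | i + 1, hi => by
    have h := List.isChain_iff_getElem.1 hl i hi
    rw [h, hl.getElem_eq i (by omega)]
    push_cast
    ring

theorem IsCyclicWord.nodup {n : ℕ} {l : List (ZMod n)} (hl : IsCyclicWord l)
    (hn : l.length ≤ n) : l.Nodup := by
  rw [List.nodup_iff_injective_get]
  intro i j hij
  simp only [List.get_eq_getElem] at hij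
  rw [hl.getElem_eq i i.2, hl.getElem_eq j j.2, add_right_inj, ZMod.natCast_eq_natCast_iff] at hij
  exact Fin.ext (hij.eq_of_lt_of_lt (i.2.trans_le hn) (j.2.trans_le hn))

/-- Over an alphabet of at least three letters, a nonempty cyclic word whose reversal is
also cyclic is a single letter. -/
theorem IsCyclicWord.eq_singleton_of_reverse {n : ℕ} (hn : 3 ≤ n) {l : List (ZMod n)}
    (hl : IsCyclicWord l) (hr : IsCyclicWord l.reverse) (hne : l ≠ []) : ∃ a, l = [a] := by
  match l, hne with
  | [a], _ => exact ⟨a, rfl⟩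
  | a :: b :: t, _ =>
    exfalso
    rw [IsCyclicWord, List.isChain_reverse] at hr
    have hab : b = a + 1 := (List.isChain_cons_cons.1 hl).1
    have hba : a = b + 1 := (List.isChain_cons_cons.1 hr).1
    have h2 : ((2 : ℕ) : ZMod n) = 0 := by
      push_cast
      linear_combination -hab - hba
    have := Nat.le_of_dvd two_pos ((ZMod.natCast_eq_zero_iff 2 n).1 h2)
    omega

theorem letterImage_factor_applyRev {V A : Type*} (h : V → List A) {p : List (V × Bool)} {z : V × Bool}
    (hz : z ∈ p) : (if z.2 then (h z.1).reverse else h z.1) <:+: applyRev h p := by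
  obtain ⟨s, t, rfl⟩ := List.append_of_mem hz
  exact ⟨applyRev h s, applyRev h t, by simp [applyRev]⟩

theorem applyRev_eq_map_flatten {V A : Type*} {h : V → List A} {a : V → A}
    {p : List (V × Bool)} (ha : ∀ z ∈ p, h z.1 = [a z.1]) :
    applyRev h p = (flatten p).map a := by
  induction p with
  | nil => rfl
  | cons z t ih =>
    have hz := ha z (by simp)
    have ht := ih fun y hy => ha y (by simp [hy])
    simp only [applyRev, flatten] at ht
    simp [applyRev, flatten, hz, ht]

/-- If every variable occurring in `φ` is two-way in `φ`, and some
variable appears twice in a single fragment of the flattening `φ^♭`, then `φ` is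
avoidable. -/
theorem avoidable_of_allTwoWay_repeat {V : Type*} [DecidableEq V]
    (φ : Set (List (V × Bool))) (hfin : φ.Finite) (hfrag : ∀ p ∈ φ, p ≠ [])
    (htwo : ∀ x : V, (Appears φ (x, false) ∨ Appears φ (x, true)) → TwoWay φ x)
    (hrep : ∃ p ∈ φ, ∃ x : V, 2 ≤ (flatten p).count x) :
    FAvoidable φ := by
  obtain ⟨p, hp, x, hx⟩ := hrep
  let n := p.length + 3
  have : NeZero n := ⟨by omega⟩
  refine ⟨ZMod n, inferInstance,
    Set.infinite_of_injective_forall_mem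
      (f := fun N : ℕ => (List.range N).map (Nat.cast : ℕ → ZMod n)) ?_ ?_⟩
  · intro M N hMN
    simpa using congrArg List.length hMN
  · rintro N ⟨h, hne, hocc⟩
    have hcyc : ∀ q ∈ φ, IsCyclicWord (applyRev h q) := fun q hq =>
      (isCyclicWord_map_range n N).factor (hocc q hq)
    have hsingle : ∀ y, Appears φ (y, false) ∨ Appears φ (y, true) → ∃ a, h y = [a] := by
      intro y hy
      obtain ⟨⟨q, hq, hyq⟩, ⟨r, hr, hyr⟩⟩ := htwo y hy
      exact ((hcyc q hq).factor (letterImage_factor_applyRev h hyq)).eq_singleton_of_reverse (by omega)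
        ((hcyc r hr).factor (letterImage_factor_applyRev h hyr)) (hne y)
    have ha : ∀ z ∈ p, h z.1 = [(h z.1).head (hne z.1)] := by
      rintro ⟨y, b⟩ hz
      obtain ⟨a, hay⟩ := hsingle y (by
        cases b
        · exact .inl ⟨p, hp, hz⟩
        · exact .inr ⟨p, hp, hz⟩)
      simp [hay]
    have hmap := applyRev_eq_map_flatten (a := fun y => (h y).head (hne y)) ha
    have hnodup := (hcyc p hp).nodup (by simp [hmap, flatten, n])
    rw [hmap] at hnodup
    have := List.nodup_iff_count_le_one.1 hnodup.of_map x
    omega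
end
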